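/- The BV bracket on PV satisfies the graded Jacobi identity: for all homogeneous A ∈ PV^p, B ∈ PV^q, C ∈ PV^r, {A,{B,C}} = {{A,B},C} + (−1)^{(p+1)(q+1)}{B,{A,C}}. -/

import Mathlib

open MvPolynomial TensorProduct

noncomputable section

/-- The exterior algebra `⋀(ℂ^N)` on the generators `θ₁,…,θ_N`. -/
abbrev ExtN (N : ℕ) := ExteriorAlgebra ℂ (Fin N → ℂ)

/-- Polynomial polyvector fields `PV = R ⊗ ⋀(ℂ^N)`. -/
abbrev PV (N : ℕ) := MvPolynomial (Fin N) ℂ ⊗[ℂ] ExtN N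

/-- Contraction (interior product) with the `k`-th dual covector. -/
def contr {N : ℕ} (k : Fin N) : ExtN N →ₗ[ℂ] ExtN N :=
  CliffordAlgebra.contractLeft (LinearMap.proj k)

/-- The BV operator `∂(α ⊗ ω) = Σ_k (∂α/∂x_k) ⊗ ι_k(ω)`. -/
def bv (N : ℕ) : PV N →ₗ[ℂ] PV N :=
  ∑ k : Fin N, TensorProduct.map (pderiv k).toLinearMap (contr k)

/-- The `p`-th exterior power, as a submodule of the exterior algebra. -/
def grE (N p : ℕ) : Submodule ℂ (ExtN N) :=
  (LinearMap.range (ExteriorAlgebra.ι ℂ : (Fin N → ℂ) →ₗ[ℂ] ExtN N)) ^ p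

/-- The graded piece `PV^p = R ⊗ ⋀^p(ℂ^N)` of `PV`. -/
def PVgr (N p : ℕ) : Submodule ℂ (PV N) :=
  LinearMap.range (TensorProduct.map (LinearMap.id : MvPolynomial (Fin N) ℂ →ₗ[ℂ] _)
    (grE N p).subtype)

/-- The BV bracket `{A,B} = (−1)^p ∂(A∧B) − (−1)^p ∂(A)∧B − A∧∂(B)` of `A ∈ PV^p` with
`B ∈ PV`. -/
def bvBracket {N : ℕ} (p : ℕ) (A B : PV N) : PV N :=
  ((-1 : ℂ) ^ p) • bv N (A * B) - ((-1 : ℂ) ^ p) • (bv N A * B) - A * bv N B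

section BVabstract

variable {S K : Type*} [Ring S] [Algebra ℂ S] [Fintype K]

theorem bvAbs_formula (d i : K → S →ₗ[ℂ] S) (σ : S →ₐ[ℂ] S) (Δ : S →ₗ[ℂ] S)
    (hΔ : ∀ x, Δ x = ∑ k, d k (i k x))
    (hd : ∀ k x y, d k (x * y) = d k x * y + x * d k y)
    (hi : ∀ k x y, i k (x * y) = i k x * y + σ x * i k y)
    (a : ℂ) (ha : a * a = 1) (A B : S) (hA : σ A = a • A) :
    a • Δ (A * B) - a • (Δ A * B) - A * Δ B
      = ∑ k, (a • (i k A * d k B) + d k A * i k B) := by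
  simp only [hΔ, hi, hA, hd, map_add, Finset.smul_sum, Finset.mul_sum, Finset.sum_mul,
    ← Finset.sum_sub_distrib]
  refine Finset.sum_congr rfl fun k _ => ?_
  simp only [map_smul, smul_add, smul_mul_assoc, smul_smul, ha, one_smul]
  abel

theorem bvAbs_jacobi (d i : K → S →ₗ[ℂ] S) (σ : S →ₐ[ℂ] S) (Δ : S →ₗ[ℂ] S)
    (hΔ : ∀ x, Δ x = ∑ k, d k (i k x))
    (hd : ∀ k x y, d k (x * y) = d k x * y + x * d k y)
    (hi : ∀ k x y, i k (x * y) = i k x * y + σ x * i k y)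
    (hσd : ∀ k x, σ (d k x) = d k (σ x))
    (hσi : ∀ k x, σ (i k x) = - i k (σ x))
    (hdd : ∀ k l x, d k (d l x) = d l (d k x))
    (hii : ∀ k l x, i k (i l x) = - i l (i k x))
    (hid : ∀ k l x, i k (d l x) = d l (i k x))
    (hc : ∀ x y, (2 : ℂ) • (x * y) = (y + σ y) * x + (y - σ y) * σ x)
    (br : ℂ → S → S → S)
    (hbr : ∀ a A B, br a A B = a • Δ (A * B) - a • (Δ A * B) - A * Δ B)
    (a b : ℂ) (ha : a = 1 ∨ a = -1) (hb : b = 1 ∨ b = -1)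
    (A B C : S) (hA : σ A = a • A) (hB : σ B = b • B) :
    br a A (br b B C) = br (-(a * b)) (br a A B) C
      + ((1 - a - b - a * b) / 2) • br b B (br a A C) := by
  have haa : a * a = 1 := by rcases ha with rfl | rfl <;> norm_num
  have hbb : b * b = 1 := by rcases hb with rfl | rfl <;> norm_num
  have hcc : ∀ (x y : ℂ) (X Y : S), σ X = x • X → σ Y = y • Y →
      X * Y = ((1 + x + y - x * y) / 2) • (Y * X) := by
    intro x y X Y hX hY
    have h := hc X Y
    rw [hX, hY] at h
    have h2 : X * Y = (1 / 2 : ℂ) • ((2 : ℂ) • (X * Y)) := by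
      rw [smul_smul]; norm_num
    rw [h2, h]
    simp only [add_mul, sub_mul, smul_mul_assoc, mul_smul_comm]
    module
  have F : ∀ (a : ℂ) (haa : a * a = 1) (A : S) (hA : σ A = a • A) (B : S),
      br a A B = ∑ k, (a • (i k A * d k B) + d k A * i k B) := by
    intro a haa A hA B
    rw [hbr]
    exact bvAbs_formula d i σ Δ hΔ hd hi a haa A B hA
  have sd : ∀ (x : ℂ) (X : S) (k : K), σ X = x • X → σ (d k X) = x • d k X := by
    intro x X k h; rw [hσd, h, map_smul]
  have si : ∀ (x : ℂ) (X : S) (k : K), σ X = x • X → σ (i k X) = (-x) • i k X := by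
    intro x X k h; rw [hσi, h, map_smul, neg_smul]
  have hAB : σ (br a A B) = (-(a * b)) • br a A B := by
    rw [F a haa A hA]
    simp only [map_sum, map_add, map_smul, map_mul, sd a A _ hA, si a A _ hA, sd b B _ hB,
      si b B _ hB, Finset.smul_sum]
    refine Finset.sum_congr rfl fun k _ => ?_
    simp only [smul_mul_assoc, mul_smul_comm]
    module
  rw [F a haa A hA, F (-(a * b)) (by linear_combination b * b * haa + hbb) _ hAB,
    F b hbb B hB, F b hbb B hB, F a haa A hA, F a haa A hA]
  have hT : ∑ k, (b • (i k B * d k (∑ l, (a • (i l A * d l C) + d l A * i l C))) +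
        d k B * i k (∑ l, (a • (i l A * d l C) + d l A * i l C)))
      = ∑ l, ∑ k, ((b * a) • (i k B * d k (i l A) * d l C) + b • (i k B * d k (d l A) * i l C)
          + a • (d k B * i k (i l A) * d l C) + d k B * i k (d l A) * i l C)
        + ∑ k, ∑ l, ((b * a) • (i k B * i l A * d k (d l C)) + b • (i k B * d l A * d k (i l C))
          - (a * a) • (d k B * i l A * i k (d l C)) + a • (d k B * d l A * i k (i l C))) := by
    rw [Finset.sum_comm, ← Finset.sum_add_distrib]
    refine Finset.sum_congr rfl fun k _ => ?_
    simp only [map_sum, Finset.smul_sum, Finset.mul_sum, ← Finset.sum_add_distrib]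
    refine Finset.sum_congr rfl fun l _ => ?_
    simp only [map_add, map_smul, hd, hi, sd a A _ hA, si a A _ hA, mul_add, smul_mul_assoc,
      mul_smul_comm, ← mul_assoc]
    module
  rw [hT, smul_add]
  have hL : ∑ k, (a • (i k A * d k (∑ l, (b • (i l B * d l C) + d l B * i l C))) +
        d k A * i k (∑ l, (b • (i l B * d l C) + d l B * i l C)))
      = ∑ l, ∑ k, (a • (i k A * d k (b • (i l B * d l C) + d l B * i l C)) +
        d k A * i k (b • (i l B * d l C) + d l B * i l C)) := by
    rw [Finset.sum_comm]
    refine Finset.sum_congr rfl fun k _ => ?_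
    simp only [map_sum, Finset.smul_sum, Finset.mul_sum, ← Finset.sum_add_distrib]
  rw [hL]
  simp only [map_sum, Finset.smul_sum, Finset.sum_mul, ← Finset.sum_add_distrib]
  refine Finset.sum_congr rfl fun l _ => Finset.sum_congr rfl fun k _ => ?_
  have dA := fun k => sd a A k hA
  have iA := fun k => si a A k hA
  have dB := fun k => sd b B k hB
  have iB := fun k => si b B k hB
  have c1 := hcc _ _ (i k B) (d k (i l A)) (iB k) (sd _ _ k (iA l))
  have c2 := hcc _ _ (i k B) (d k (d l A)) (iB k) (sd _ _ k (dA l))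
  have c3 := hcc _ _ (d k B) (i k (i l A)) (dB k) (si _ _ k (iA l))
  have c4 := hcc _ _ (d k B) (d l (i k A)) (dB k) (sd _ _ l (iA k))
  have c5 := hcc _ _ (i l B) (i k A) (iB l) (iA k)
  have c6 := hcc _ _ (i l B) (d k A) (iB l) (dA k)
  have c7 := hcc _ _ (d l B) (i k A) (dB l) (iA k)
  have c8 := hcc _ _ (d l B) (d k A) (dB l) (dA k)
  simp only [hid, map_add, map_smul, hd, hi, dA, iA, dB, iB, mul_add, add_mul, smul_mul_assoc,
      mul_smul_comm, ← mul_assoc, smul_add, smul_sub, c1, c2, c3, c4, c5, c6, c7, c8]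
  rw [hii l k A, hii l k B, hii l k C, hdd l k A, hdd l k B, hdd l k C]
  simp only [neg_mul, mul_neg]
  rcases ha with rfl | rfl <;> rcases hb with rfl | rfl <;> module

end BVabstract

theorem ext_supercomm {N : ℕ} (x y : ExtN N) :
    (2 : ℂ) • (x * y) = (y + CliffordAlgebra.involute y) * x
      + (y - CliffordAlgebra.involute y) * CliffordAlgebra.involute x := by
  have hv : ∀ (v : Fin N → ℂ) (y : ExtN N), CliffordAlgebra.ι (0 : QuadraticForm ℂ (Fin N → ℂ)) v * y
      = CliffordAlgebra.involute y * CliffordAlgebra.ι (0 : QuadraticForm ℂ (Fin N → ℂ)) v := by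
    intro v y
    induction y using CliffordAlgebra.induction with
    | algebraMap r => rw [AlgHom.commutes]; exact (Algebra.commutes r _).symm
    | ι w =>
      rw [CliffordAlgebra.involute_ι, neg_mul]
      exact eq_neg_of_add_eq_zero_left (ExteriorAlgebra.ι_add_mul_swap v w)
    | mul a b ha hb => rw [← mul_assoc, ha, mul_assoc, hb, map_mul, mul_assoc]
    | add a b ha hb => rw [mul_add, ha, hb, map_add, add_mul]
  induction x using CliffordAlgebra.induction generalizing y with
  | algebraMap r =>
    rw [AlgHom.commutes, ← add_mul, ← Algebra.commutes r, two_smul, ← mul_add]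
    congr 1; abel
  | ι w =>
    rw [CliffordAlgebra.involute_ι, hv, two_smul]
    noncomm_ring
  | mul a b ha hb =>
    have e1 : (2 : ℂ) • (a * b * y) = a * ((2 : ℂ) • (b * y)) := by
      rw [mul_assoc, mul_smul_comm]
    have h1 := ha (y + CliffordAlgebra.involute y)
    have h2 := ha (y - CliffordAlgebra.involute y)
    simp only [map_add, map_sub, CliffordAlgebra.involute_involute] at h1 h2
    have e2 : a * (y + CliffordAlgebra.involute y) = (y + CliffordAlgebra.involute y) * a := by
      have : (2 : ℂ) • (a * (y + CliffordAlgebra.involute y))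
          = (2 : ℂ) • ((y + CliffordAlgebra.involute y) * a) := by
        rw [h1, two_smul]; noncomm_ring
      exact smul_right_injective _ (two_ne_zero) this
    have e3 : a * (y - CliffordAlgebra.involute y)
        = (y - CliffordAlgebra.involute y) * CliffordAlgebra.involute a := by
      have : (2 : ℂ) • (a * (y - CliffordAlgebra.involute y))
          = (2 : ℂ) • ((y - CliffordAlgebra.involute y) * CliffordAlgebra.involute a) := by
        rw [h2, two_smul]; noncomm_ring
      exact smul_right_injective _ (two_ne_zero) this
    rw [e1, hb, mul_add, ← mul_assoc, ← mul_assoc, e2, e3, map_mul, mul_assoc, mul_assoc]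
  | add a b ha hb =>
    rw [add_mul, smul_add, ha, hb, map_add, mul_add, mul_add]; abel

theorem contr_mul {N : ℕ} (k : Fin N) (x y : ExtN N) :
    contr k (x * y) = contr k x * y + CliffordAlgebra.involute x * contr k y := by
  induction x using CliffordAlgebra.induction generalizing y with
  | algebraMap r =>
    unfold contr
    rw [CliffordAlgebra.contractLeft_algebraMap_mul, CliffordAlgebra.contractLeft_algebraMap,
      AlgHom.commutes, zero_mul, zero_add]
  | ι w =>
    unfold contr
    rw [CliffordAlgebra.contractLeft_ι_mul, CliffordAlgebra.contractLeft_ι,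
      CliffordAlgebra.involute_ι, neg_mul, Algebra.smul_def, sub_eq_add_neg]
  | mul a b ha hb => rw [mul_assoc, ha, hb, ha b, map_mul]; noncomm_ring
  | add a b ha hb => rw [add_mul, map_add, ha, hb, map_add, map_add]; noncomm_ring

theorem involute_contr {N : ℕ} (k : Fin N) (x : ExtN N) :
    CliffordAlgebra.involute (contr k x) = - contr k (CliffordAlgebra.involute x) := by
  induction x using CliffordAlgebra.induction with
  | algebraMap r =>
    unfold contr
    rw [AlgHom.commutes, CliffordAlgebra.contractLeft_algebraMap, map_zero, neg_zero]
  | ι w =>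
    unfold contr
    rw [CliffordAlgebra.involute_ι, map_neg, neg_neg, CliffordAlgebra.contractLeft_ι,
      AlgHom.commutes]
  | mul a b ha hb =>
    rw [contr_mul, map_mul, contr_mul, map_add, map_mul, map_mul, ha, hb]; noncomm_ring
  | add a b ha hb => rw [map_add, map_add, ha, hb, map_add, map_add]; abel

theorem involute_grE {N p : ℕ} (x : ExtN N) (hx : x ∈ grE N p) :
    CliffordAlgebra.involute x = ((-1 : ℂ) ^ p) • x := by
  unfold grE at hx
  induction p generalizing x with
  | zero =>
    rw [pow_zero, Submodule.mem_one] at hx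
    obtain ⟨r, rfl⟩ := hx
    rw [pow_zero, one_smul]
    exact AlgHom.commutes _ _
  | succ n ih =>
    rw [pow_succ] at hx
    refine Submodule.mul_induction_on hx ?_ ?_
    · rintro m hm _ ⟨v, rfl⟩
      have h : CliffordAlgebra.involute (ExteriorAlgebra.ι ℂ v) = - ExteriorAlgebra.ι ℂ v :=
        CliffordAlgebra.involute_ι v
      rw [map_mul, ih m hm, h, pow_succ]
      simp
    · intro x y hx hy
      rw [map_add, hx, hy, smul_add]

/-- Grade involution on `PV`. -/
def pvInv (N : ℕ) : PV N →ₐ[ℂ] PV N :=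
  Algebra.TensorProduct.map (AlgHom.id ℂ _) CliffordAlgebra.involute

/-- Coefficient derivative on `PV`. -/
def pvD {N : ℕ} (k : Fin N) : PV N →ₗ[ℂ] PV N :=
  TensorProduct.map (pderiv k).toLinearMap LinearMap.id

/-- Contraction on `PV`. -/
def pvI {N : ℕ} (k : Fin N) : PV N →ₗ[ℂ] PV N :=
  TensorProduct.map LinearMap.id (contr k)

theorem pvInv_tmul {N : ℕ} (f : MvPolynomial (Fin N) ℂ) (w : ExtN N) :
    pvInv N (f ⊗ₜ w) = f ⊗ₜ CliffordAlgebra.involute w := rfl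

theorem pvD_tmul {N : ℕ} (k : Fin N) (f : MvPolynomial (Fin N) ℂ) (w : ExtN N) :
    pvD k (f ⊗ₜ w) = pderiv k f ⊗ₜ w := rfl

theorem pvI_tmul {N : ℕ} (k : Fin N) (f : MvPolynomial (Fin N) ℂ) (w : ExtN N) :
    pvI k (f ⊗ₜ w) = f ⊗ₜ contr k w := rfl

theorem pderiv_comm' {N : ℕ} (k l : Fin N) (f : MvPolynomial (Fin N) ℂ) :
    pderiv k (pderiv l f) = pderiv l (pderiv k f) := by
  have h : ⁅(pderiv k : Derivation ℂ (MvPolynomial (Fin N) ℂ) (MvPolynomial (Fin N) ℂ)),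
      (pderiv l : Derivation ℂ (MvPolynomial (Fin N) ℂ) (MvPolynomial (Fin N) ℂ))⁆ = 0 := by
    apply MvPolynomial.derivation_ext
    intro j
    simp only [Derivation.commutator_apply, pderiv_X, Pi.single_apply]
    split_ifs <;> simp
  have h2 := congrArg (fun D => D f) h
  simp only [Derivation.commutator_apply] at h2
  exact sub_eq_zero.mp h2

theorem pvInv_gr {N p : ℕ} (A : PV N) (hA : A ∈ PVgr N p) :
    pvInv N A = ((-1 : ℂ) ^ p) • A := by
  obtain ⟨t, rfl⟩ := hA
  induction t using TensorProduct.induction_on with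
  | zero => simp
  | tmul f w =>
    rw [TensorProduct.map_tmul, pvInv_tmul]
    rw [Submodule.subtype_apply, involute_grE _ w.2, TensorProduct.tmul_smul]
  | add x y hx hy => rw [map_add, map_add, hx, hy, smul_add]



/-- The graded Jacobi identity for the BV bracket: for homogeneous `A ∈ PV^p`, `B ∈ PV^q`,
`C ∈ PV^r`, `{A,{B,C}} = {{A,B},C} + (−1)^{(p+1)(q+1)}{B,{A,C}}` (note that `{A,B}` is
homogeneous of degree `p + q − 1`, so the sign in its bracket with `C` is
`(−1)^{p+q−1} = (−1)^{p+q+1}`). -/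
theorem bvBracket_jacobi (N : ℕ) (hN : 0 < N) (p q r : ℕ)
    (A : PV N) (hA : A ∈ PVgr N p) (B : PV N) (hB : B ∈ PVgr N q)
    (C : PV N) (hC : C ∈ PVgr N r) :
    bvBracket p A (bvBracket q B C) =
      bvBracket (p + q + 1) (bvBracket p A B) C +
        ((-1 : ℂ) ^ ((p + 1) * (q + 1))) • bvBracket q B (bvBracket p A C) := by
  have hbr : ∀ (n : ℕ) (a : ℂ) (X Y : PV N), (-1 : ℂ) ^ n = a → bvBracket n X Y
      = a • bv N (X * Y) - a • (bv N X * Y) - X * bv N Y := by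
    rintro n a X Y rfl; rfl
  have key := bvAbs_jacobi (S := PV N) (fun k => pvD k) (fun k => pvI k) (pvInv N) (bv N)
    ?_ ?_ ?_ ?_ ?_ ?_ ?_ ?_ ?_
    (fun a X Y => a • bv N (X * Y) - a • (bv N X * Y) - X * bv N Y) (fun _ _ _ => rfl)
    ((-1) ^ p) ((-1) ^ q) (neg_one_pow_eq_or ℂ p) (neg_one_pow_eq_or ℂ q) A B C
    (pvInv_gr A hA) (pvInv_gr B hB)
  · have e1 : (-1 : ℂ) ^ (p + q + 1) = -((-1) ^ p * (-1) ^ q) := by ring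
    have e2 : (-1 : ℂ) ^ ((p + 1) * (q + 1))
        = (1 - (-1) ^ p - (-1) ^ q - (-1) ^ p * (-1) ^ q) / 2 := by
      rw [pow_mul, pow_succ]
      rcases neg_one_pow_eq_or ℂ p with h | h <;> rcases neg_one_pow_eq_or ℂ q with h' | h' <;>
        simp only [h, h', pow_succ, mul_neg, mul_one, neg_neg, one_pow] <;> norm_num
    rw [e2]
    unfold bvBracket
    rw [e1]
    exact key
  · intro x
    unfold bv
    rw [LinearMap.sum_apply]
    refine Finset.sum_congr rfl fun k _ => ?_
    induction x using TensorProduct.induction_on with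
    | zero => simp
    | tmul f w => rfl
    | add x y hx hy => simp only [map_add, hx, hy]
  · intro k x y
    induction x using TensorProduct.induction_on with
    | zero => simp
    | add x x' hx hx' => simp only [map_add, add_mul, hx, hx']; abel
    | tmul f w =>
      induction y using TensorProduct.induction_on with
      | zero => simp
      | add x x' hx hx' => simp only [map_add, mul_add, hx, hx']; abel
      | tmul g v =>
        simp only [Algebra.TensorProduct.tmul_mul_tmul, pvD_tmul, Derivation.leibniz,
          smul_eq_mul, ← TensorProduct.add_tmul]
        congr 1; ring
  · intro k x y
    induction x using TensorProduct.induction_on with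
    | zero => simp
    | add x x' hx hx' => simp only [map_add, add_mul, hx, hx']; abel
    | tmul f w =>
      induction y using TensorProduct.induction_on with
      | zero => simp
      | add x x' hx hx' => simp only [map_add, mul_add, hx, hx']; abel
      | tmul g v =>
        simp only [Algebra.TensorProduct.tmul_mul_tmul, pvI_tmul, pvInv_tmul, contr_mul,
          ← TensorProduct.tmul_add]
  · intro k x
    induction x using TensorProduct.induction_on with
    | zero => simp
    | tmul f w => rfl
    | add x y hx hy => simp only [map_add, hx, hy]
  · intro k x
    induction x using TensorProduct.induction_on with
    | zero => simp
    | tmul f w => simp only [pvI_tmul, pvInv_tmul, involute_contr, TensorProduct.tmul_neg]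
    | add x y hx hy => simp only [map_add, hx, hy, neg_add]
  · intro k l x
    induction x using TensorProduct.induction_on with
    | zero => simp
    | tmul f w => simp only [pvD_tmul, pderiv_comm' k l]
    | add x y hx hy => simp only [map_add, hx, hy]
  · intro k l x
    induction x using TensorProduct.induction_on with
    | zero => simp
    | tmul f w =>
      have h : contr k (contr l w) = - contr l (contr k w) :=
        CliffordAlgebra.contractLeft_comm _ _ w
      simp only [pvI_tmul, h, TensorProduct.tmul_neg]
    | add x y hx hy => simp only [map_add, hx, hy, neg_add]
  · intro k l x
    induction x using TensorProduct.induction_on with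
    | zero => simp
    | tmul f w => rfl
    | add x y hx hy => simp only [map_add, hx, hy]
  · intro x y
    induction x using TensorProduct.induction_on with
    | zero => simp
    | add x x' hx hx' => simp only [map_add, add_mul, mul_add, smul_add, hx, hx']; abel
    | tmul f w =>
      induction y using TensorProduct.induction_on with
      | zero => simp
      | add x x' hx hx' =>
        rw [mul_add, smul_add, hx, hx', map_add]
        simp only [add_mul, sub_mul]; abel
      | tmul g v =>
        simp only [pvInv_tmul, ← TensorProduct.tmul_add, ← TensorProduct.tmul_sub,
          Algebra.TensorProduct.tmul_mul_tmul]
        rw [← TensorProduct.tmul_smul, ext_supercomm, mul_comm g f, TensorProduct.tmul_add]
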